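/- arXiv:2010.00537 — 2 statements merged into one kernel-verified Lean document; each statement's English description precedes it below -/
import Mathlib

section
/- Assume F is monotone and Lipschitz in each argument with constant L_F, A is nondecreasing and Lipschitz with constant L_A, and the CFL condition 2 L_F Δt/Δx + (2^{λ+1} c L_A/λ) Δt/Δx^λ ≤ 1 holds. Then the one-step explicit finite-difference operator H is monotone on bounded sequences: if U, V : ℤ → ℝ are bounded and U_i ≤ V_i for all i ∈ ℤ, then H(U)_i ≤ H(V)_i for all i ∈ ℤ. (This is the monotonicity of the explicit scheme under the CFL condition, the basis for all the stability estimates of Theorem 3.1.) -/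
open MeasureTheory

/-- The finite-difference weights `G_j = c ∫_{(|j|−1/2)Δx}^{(|j|+1/2)Δx} z^{−1−λ} dz`
discretizing the one-dimensional fractional Laplacian. -/
noncomputable def fracWeight (c lam Δx : ℝ) (j : ℤ) : ℝ :=
  ∫ z in ((|j| : ℝ) - 1/2) * Δx..((|j| : ℝ) + 1/2) * Δx, c * z ^ (-1 - lam)

/-- The one-step explicit finite-difference operator
`H(U)_i = U_i − (Δt/Δx)(F(U_i,U_{i+1}) − F(U_{i−1},U_i))
          + Δt ∑_{j≠0} G_j (A(U_{i+j}) − A(U_i))`. -/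
noncomputable def schemeH (c lam Δx Δt : ℝ) (F : ℝ → ℝ → ℝ) (A : ℝ → ℝ)
    (U : ℤ → ℝ) (i : ℤ) : ℝ :=
  U i - Δt / Δx * (F (U i) (U (i + 1)) - F (U (i - 1)) (U i))
    + Δt * ∑' j : {j : ℤ // j ≠ 0}, fracWeight c lam Δx j.1 * (A (U (i + j.1)) - A (U i))

theorem fracWeight_neg_aux (c lam Δx : ℝ) (j : ℤ) :
    fracWeight c lam Δx (-j) = fracWeight c lam Δx j := by
  unfold fracWeight
  simp

theorem fracWeight_succ_aux (c lam Δx : ℝ) (hlam₀ : 0 < lam) (hΔx : 0 < Δx) (n : ℕ) :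
    fracWeight c lam Δx ((n : ℤ) + 1)
      = c / lam * ((((n : ℝ) + 1 / 2) * Δx) ^ (-lam)
        - ((((n + 1 : ℕ) : ℝ) + 1 / 2) * Δx) ^ (-lam)) := by
  have hn : (0 : ℝ) ≤ n := Nat.cast_nonneg n
  have e : |(((n : ℤ) + 1 : ℤ) : ℝ)| = n + 1 := by
    push_cast
    exact abs_of_nonneg (by linarith)
  unfold fracWeight
  rw [e, intervalIntegral.integral_const_mul, integral_rpow]
  · have e1 : -1 - lam + 1 = -lam := by ring
    have e2 : (n : ℝ) + 1 - 1 / 2 = n + 1 / 2 := by ring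
    rw [e1, e2]
    push_cast
    field_simp
    ring
  · right
    refine ⟨by linarith, ?_⟩
    rw [Set.uIcc_of_le (by nlinarith)]
    intro h
    have h1 := h.1
    have : 0 < ((n : ℝ) + 1 - 1 / 2) * Δx := mul_pos (by linarith) hΔx
    linarith

theorem fracWeight_succ_nonneg_aux (c lam Δx : ℝ) (hlam₀ : 0 < lam) (hc : 0 < c) (hΔx : 0 < Δx)
    (n : ℕ) : 0 ≤ fracWeight c lam Δx ((n : ℤ) + 1) := by
  rw [fracWeight_succ_aux c lam Δx hlam₀ hΔx]
  have hn : (0 : ℝ) ≤ n := Nat.cast_nonneg n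
  refine mul_nonneg (by positivity) (sub_nonneg.2 ?_)
  apply Real.rpow_le_rpow_of_nonpos (by positivity) _ (by linarith)
  push_cast
  nlinarith

theorem fracWeight_nonneg_aux (c lam Δx : ℝ) (hlam₀ : 0 < lam) (hc : 0 < c) (hΔx : 0 < Δx)
    (j : ℤ) (hj : j ≠ 0) : 0 ≤ fracWeight c lam Δx j := by
  have key : ∀ k : ℤ, 0 < k → 0 ≤ fracWeight c lam Δx k := by
    intro k hk
    have := fracWeight_succ_nonneg_aux c lam Δx hlam₀ hc hΔx (k - 1).toNat
    rwa [show (((k - 1).toNat : ℤ) + 1) = k by omega] at this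
  rcases lt_or_gt_of_ne hj with h | h
  · rw [← fracWeight_neg_aux]
    exact key _ (by omega)
  · exact key _ h

theorem fracWeight_hasSum_nat_aux (c lam Δx : ℝ) (hlam₀ : 0 < lam) (hc : 0 < c) (hΔx : 0 < Δx) :
    HasSum (fun n : ℕ => fracWeight c lam Δx ((n : ℤ) + 1))
      (c / lam * ((1 / 2) * Δx) ^ (-lam)) := by
  rw [hasSum_iff_tendsto_nat_of_nonneg (fracWeight_succ_nonneg_aux c lam Δx hlam₀ hc hΔx)]
  have e : (fun N : ℕ => ∑ n ∈ Finset.range N, fracWeight c lam Δx ((n : ℤ) + 1))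
      = fun N : ℕ => c / lam * (((1 / 2) * Δx) ^ (-lam) - (((N : ℝ) + 1 / 2) * Δx) ^ (-lam)) := by
    funext N
    simp_rw [fracWeight_succ_aux c lam Δx hlam₀ hΔx]
    rw [← Finset.mul_sum,
      Finset.sum_range_sub' (fun n : ℕ => (((n : ℝ) + 1 / 2) * Δx) ^ (-lam))]
    simp
  rw [e]
  have t : Filter.Tendsto (fun N : ℕ => (((N : ℝ) + 1 / 2) * Δx) ^ (-lam)) Filter.atTop
      (nhds 0) := by
    apply (tendsto_rpow_neg_atTop hlam₀).comp
    apply Filter.Tendsto.atTop_mul_const hΔx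
    exact Filter.tendsto_atTop_add_const_right _ _ tendsto_natCast_atTop_atTop
  simpa using (t.const_sub (((1 / 2) * Δx) ^ (-lam))).const_mul (c / lam)

theorem fracWeight_hasSum_aux (c lam Δx : ℝ) (hlam₀ : 0 < lam) (hc : 0 < c) (hΔx : 0 < Δx) :
    HasSum (fun j : {j : ℤ // j ≠ 0} => fracWeight c lam Δx j.1)
      (2 ^ (lam + 1) * c / lam / Δx ^ lam) := by
  have h := fracWeight_hasSum_nat_aux c lam Δx hlam₀ hc hΔx
  have hs : HasSum (({j : ℤ | j ≠ 0} : Set ℤ).indicator (fracWeight c lam Δx))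
      (2 ^ (lam + 1) * c / lam / Δx ^ lam) := by
    have h1 : HasSum (fun n : ℕ =>
        ({j : ℤ | j ≠ 0} : Set ℤ).indicator (fracWeight c lam Δx) (n : ℤ))
        (c / lam * ((1 / 2) * Δx) ^ (-lam)) := by
      rw [← hasSum_nat_add_iff' 1]
      simp only [Finset.range_one, Finset.sum_singleton]
      convert h using 1
      · rfl
      · funext n
        have : ((n : ℤ) + 1) ≠ 0 := by omega
        simp [Set.indicator, this]
      · simp
    have h2 : HasSum (fun n : ℕ =>
        ({j : ℤ | j ≠ 0} : Set ℤ).indicator (fracWeight c lam Δx) (-((n : ℤ) + 1)))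
        (c / lam * ((1 / 2) * Δx) ^ (-lam)) := by
      convert h using 1
      funext n
      have : (-((n : ℤ) + 1)) ≠ 0 := by omega
      rw [Set.indicator_of_mem (by exact this), fracWeight_neg_aux]
    convert h1.of_nat_of_neg_add_one h2 using 1
    rw [Real.mul_rpow (by norm_num) hΔx.le, Real.rpow_neg hΔx.le, one_div,
      Real.inv_rpow (by norm_num), Real.rpow_neg (by norm_num), inv_inv,
      Real.rpow_add (by norm_num), Real.rpow_one]
    field_simp
    ring
  exact (hasSum_subtype_iff_indicator (s := {j : ℤ | j ≠ 0})).2 hs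

theorem summable_term_aux (c lam Δx : ℝ) (hlam₀ : 0 < lam) (hc : 0 < c) (hΔx : 0 < Δx)
    (A : ℝ → ℝ) (LA : ℝ) (hLA : 0 ≤ LA) (hAlip : ∀ a b, |A a - A b| ≤ LA * |a - b|)
    (U : ℤ → ℝ) (hU : ∃ K : ℝ, ∀ i, |U i| ≤ K) (i : ℤ) :
    Summable (fun j : {j : ℤ // j ≠ 0} =>
      fracWeight c lam Δx j.1 * (A (U (i + j.1)) - A (U i))) := by
  obtain ⟨K, hK⟩ := hU
  refine Summable.of_norm_bounded
    ((fracWeight_hasSum_aux c lam Δx hlam₀ hc hΔx).summable.mul_right (LA * (K + K))) ?_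
  intro j
  have hg := fracWeight_nonneg_aux c lam Δx hlam₀ hc hΔx j.1 j.2
  rw [norm_mul, Real.norm_eq_abs, Real.norm_eq_abs, abs_of_nonneg hg]
  refine mul_le_mul_of_nonneg_left ((hAlip _ _).trans ?_) hg
  refine mul_le_mul_of_nonneg_left ?_ hLA
  exact (abs_sub _ _).trans (add_le_add (hK _) (hK _))

/-- monotonicity of the explicit scheme under the CFL condition
`2 L_F Δt/Δx + (2^{λ+1} c L_A/λ) Δt/Δx^λ ≤ 1`: if `U ≤ V` pointwise (both
bounded), then `H(U) ≤ H(V)` pointwise. -/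
theorem explicit_scheme_monotone
    (lam c Δx Δt : ℝ) (hlam₀ : 0 < lam) (hlam₂ : lam < 2) (hc : 0 < c)
    (hΔx : 0 < Δx) (hΔt : 0 < Δt)
    (F : ℝ → ℝ → ℝ) (A : ℝ → ℝ) (LF LA : ℝ)
    (hFmono₁ : ∀ v, Monotone fun u => F u v)
    (hFmono₂ : ∀ u, Antitone fun v => F u v)
    (hFlip₁ : ∀ u u' v, |F u v - F u' v| ≤ LF * |u - u'|)
    (hFlip₂ : ∀ u v v', |F u v - F u v'| ≤ LF * |v - v'|)
    (hAmono : Monotone A)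
    (hAlip : ∀ a b, |A a - A b| ≤ LA * |a - b|)
    (hCFL : 2 * LF * Δt / Δx + 2 ^ (lam + 1) * c * LA / lam * (Δt / Δx ^ lam) ≤ 1)
    (U V : ℤ → ℝ)
    (hU : ∃ K : ℝ, ∀ i, |U i| ≤ K) (hV : ∃ K : ℝ, ∀ i, |V i| ≤ K)
    (hUV : ∀ i, U i ≤ V i) :
    ∀ i, schemeH c lam Δx Δt F A U i ≤ schemeH c lam Δx Δt F A V i := by
  intro i
  have hLA : 0 ≤ LA := by
    have := (abs_nonneg _).trans (hAlip 1 0)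
    simpa using this
  have hS := fracWeight_hasSum_aux c lam Δx hlam₀ hc hΔx
  have sU := summable_term_aux c lam Δx hlam₀ hc hΔx A LA hLA hAlip U hU i
  have sV := summable_term_aux c lam Δx hlam₀ hc hΔx A LA hLA hAlip V hV i
  have hd : 0 ≤ V i - U i := sub_nonneg.2 (hUV i)
  have key := Summable.tsum_le_tsum (fun j : {j : ℤ // j ≠ 0} => by
    have hg := fracWeight_nonneg_aux c lam Δx hlam₀ hc hΔx j.1 j.2
    have h1 := hAmono (hUV (i + j.1))
    have h2 := (le_abs_self _).trans (hAlip (V i) (U i))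
    rw [abs_of_nonneg hd] at h2
    show fracWeight c lam Δx j.1 * (A (U (i + j.1)) - A (U i)) ≤
      fracWeight c lam Δx j.1 * (A (V (i + j.1)) - A (V i))
        + fracWeight c lam Δx j.1 * (LA * (V i - U i))
    rw [← mul_add]
    exact mul_le_mul_of_nonneg_left (by linarith) hg) sU
    (sV.add (hS.summable.mul_right (LA * (V i - U i))))
  rw [sV.tsum_add (hS.summable.mul_right _), tsum_mul_right, hS.tsum_eq] at key
  have f1 : F (V i) (V (i + 1)) - F (U i) (U (i + 1)) ≤ LF * (V i - U i) := by
    have h1 := hFmono₂ (V i) (hUV (i + 1))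
    have h2 := (le_abs_self _).trans (hFlip₁ (V i) (U i) (U (i + 1)))
    rw [abs_of_nonneg hd] at h2
    simp only at h1
    linarith
  have f2 : F (U (i - 1)) (U i) - F (V (i - 1)) (V i) ≤ LF * (V i - U i) := by
    have h1 := hFmono₁ (V i) (hUV (i - 1))
    have h2 := (le_abs_self _).trans (hFlip₂ (U (i - 1)) (U i) (V i))
    rw [abs_sub_comm (U i), abs_of_nonneg hd] at h2
    simp only at h1
    linarith
  have hr : 0 < Δt / Δx := div_pos hΔt hΔx
  have g := mul_le_mul_of_nonneg_left (add_le_add f1 f2) hr.le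
  have k := mul_le_mul_of_nonneg_left key hΔt.le
  have C := mul_le_mul_of_nonneg_right hCFL hd
  have e : (2 * LF * Δt / Δx + 2 ^ (lam + 1) * c * LA / lam * (Δt / Δx ^ lam)) * (V i - U i)
      = Δt / Δx * (LF * (V i - U i) + LF * (V i - U i))
        + Δt * (2 ^ (lam + 1) * c / lam / Δx ^ lam * (LA * (V i - U i))) := by
    ring
  rw [e] at C
  unfold schemeH
  rw [mul_add] at k
  linarith
end

section
/- Assume F is monotone and Lipschitz in each argument with constant L_F, A is nondecreasing and Lipschitz with constant L_A, and the CFL condition 2 L_F Δt/Δx + (2^{λ+1} c L_A/λ) Δt/Δx^λ ≤ 1 holds. Then for every bounded sequence U : ℤ → ℝ the explicit scheme satisfies the discrete maximum principle inf_{k∈ℤ} U_k ≤ H(U)_i ≤ sup_{k∈ℤ} U_k for every i ∈ ℤ; in particular sup_i |H(U)_i| ≤ sup_i |U_i|, so by induction the numerical solution satisfies the L^∞ bound ‖u_Δ(t^n, ·)‖_{L^∞} ≤ ‖u_0‖_{L^∞} of Theorem 3.1(i). -/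
open MeasureTheory

lemma fracWeight_natAbs (c lam Δx : ℝ) (hlam : 0 < lam) (hΔx : 0 < Δx) (j : ℤ) (n : ℕ)
    (hj : |(j : ℝ)| = n + 1) :
    fracWeight c lam Δx j = c / lam * (((n : ℝ) + 1/2) * Δx) ^ (-lam)
      - c / lam * (((n + 1 : ℕ) : ℝ) + 1/2) ^ (-lam) * Δx ^ (-lam) := by
  have hn : (0 : ℝ) ≤ n := Nat.cast_nonneg n
  unfold fracWeight
  rw [hj, intervalIntegral.integral_const_mul, integral_rpow]
  · have h1 : -1 - lam + 1 = -lam := by ring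
    have h2 : ((n : ℝ) + 1 - 1/2) = n + 1/2 := by ring
    rw [h1, h2, mul_assoc, ← Real.mul_rpow (by positivity) hΔx.le]
    push_cast
    field_simp
    ring
  · right
    refine ⟨by linarith, ?_⟩
    rw [Set.uIcc_of_le (by nlinarith)]
    intro h
    have : 0 < ((n : ℝ) + 1 - 1/2) * Δx := by
      apply mul_pos _ hΔx
      linarith
    linarith [h.1]

lemma fracWeight_nonneg (c lam Δx : ℝ) (hc : 0 < c) (hΔx : 0 < Δx) (j : ℤ) (hj : j ≠ 0) :
    0 ≤ fracWeight c lam Δx j := by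
  have h1 : (1 : ℝ) ≤ |(j : ℝ)| := by
    exact_mod_cast Int.one_le_abs hj
  unfold fracWeight
  apply intervalIntegral.integral_nonneg
  · nlinarith
  · intro z hz
    have h0 : 0 ≤ (|(j : ℝ)| - 1/2) * Δx := by
      apply mul_nonneg _ hΔx.le
      linarith
    have : 0 ≤ z := h0.trans hz.1
    positivity

lemma fracWeight_half (c lam Δx : ℝ) (hlam : 0 < lam) (hc : 0 < c) (hΔx : 0 < Δx)
    (e : ℕ → ℤ) (he : ∀ n, |((e n : ℤ) : ℝ)| = n + 1) :
    HasSum (fun n : ℕ => fracWeight c lam Δx (e n)) (c / lam * (1/2 * Δx) ^ (-lam)) := by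
  have hne : ∀ n, e n ≠ 0 := by
    intro n h
    have h2 := he n
    rw [h] at h2
    have hn : (0 : ℝ) ≤ n := Nat.cast_nonneg n
    simp at h2
    linarith
  rw [hasSum_iff_tendsto_nat_of_nonneg
    (fun n => fracWeight_nonneg c lam Δx hc hΔx (e n) (hne n))]
  have hsum : ∀ N : ℕ, ∑ n ∈ Finset.range N, fracWeight c lam Δx (e n)
      = c / lam * (1/2 * Δx) ^ (-lam) - c / lam * (((N : ℝ) + 1/2) * Δx) ^ (-lam) := by
    intro N
    have := Finset.sum_range_sub' (fun n : ℕ => c / lam * (((n : ℝ) + 1/2) * Δx) ^ (-lam)) N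
    simp only [Nat.cast_zero, zero_add] at this
    rw [← this]
    apply Finset.sum_congr rfl
    intro n _
    rw [fracWeight_natAbs c lam Δx hlam hΔx (e n) n (he n), mul_assoc,
      ← Real.mul_rpow (by positivity) hΔx.le]
  simp_rw [hsum]
  have ht : Filter.Tendsto (fun N : ℕ => ((N : ℝ) + 1/2) * Δx) Filter.atTop Filter.atTop :=
    (Filter.tendsto_atTop_add_const_right _ _ tendsto_natCast_atTop_atTop).atTop_mul_const hΔx
  have h0 := (tendsto_rpow_neg_atTop hlam).comp ht
  have h1 := (h0.const_mul (c / lam)).const_sub (c / lam * (1/2 * Δx) ^ (-lam))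
  simpa using h1

lemma fracWeight_hasSum (c lam Δx : ℝ) (hlam : 0 < lam) (hc : 0 < c) (hΔx : 0 < Δx) :
    HasSum (fun j : {j : ℤ // j ≠ 0} => fracWeight c lam Δx j.1)
      (2 ^ (lam + 1) * c / lam / Δx ^ lam) := by
  have hp := fracWeight_half c lam Δx hlam hc hΔx (fun n => (n : ℤ) + 1) (by
    intro n
    push_cast
    rw [abs_of_nonneg (by positivity)])
  have hm := fracWeight_half c lam Δx hlam hc hΔx (fun n => -((n : ℤ) + 1)) (by
    intro n
    push_cast
    rw [abs_neg, abs_of_nonneg (by positivity)])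
  have key : HasSum (Set.indicator {j : ℤ | j ≠ 0} (fracWeight c lam Δx))
      (c / lam * (1/2 * Δx) ^ (-lam)
        + Set.indicator {j : ℤ | j ≠ 0} (fracWeight c lam Δx) 0
        + c / lam * (1/2 * Δx) ^ (-lam)) := by
    apply HasSum.of_add_one_of_neg_add_one
    · convert hp using 2 with n
      apply Set.indicator_of_mem
      simp only [Set.mem_ofPred_eq]
      omega
    · convert hm using 2 with n
      apply Set.indicator_of_mem
      simp only [Set.mem_ofPred_eq]
      omega
  have hz : Set.indicator {j : ℤ | j ≠ 0} (fracWeight c lam Δx) 0 = 0 := by simp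
  have key2 := ((Subtype.val_injective (p := fun j : ℤ => j ≠ 0)).hasSum_iff (by
    intro x hx
    have hx0 : x = 0 := by simpa using hx
    rw [hx0, hz])).mpr key
  have hfun : (fun j : {j : ℤ // j ≠ 0} => fracWeight c lam Δx j.1)
      = Set.indicator {j : ℤ | j ≠ 0} (fracWeight c lam Δx) ∘ Subtype.val := by
    funext j
    exact (Set.indicator_of_mem (s := {j : ℤ | j ≠ 0}) j.2 _).symm
  rw [hfun]
  convert key2 using 1
  rw [hz]
  rw [Real.mul_rpow (by norm_num) hΔx.le, Real.rpow_add_one (by norm_num),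
    Real.rpow_neg hΔx.le, Real.rpow_neg (by norm_num), one_div, Real.inv_rpow (by norm_num)]
  field_simp
  ring

/-- discrete maximum principle for the explicit scheme under the
CFL condition: `inf_k U_k ≤ H(U)_i ≤ sup_k U_k` for every `i`, and in particular
`sup_i |H(U)_i| ≤ sup_i |U_i|`. -/
theorem explicit_scheme_max_principle
    (lam c Δx Δt : ℝ) (hlam₀ : 0 < lam) (hlam₂ : lam < 2) (hc : 0 < c)
    (hΔx : 0 < Δx) (hΔt : 0 < Δt)
    (F : ℝ → ℝ → ℝ) (A : ℝ → ℝ) (LF LA : ℝ)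
    (hFmono₁ : ∀ v, Monotone fun u => F u v)
    (hFmono₂ : ∀ u, Antitone fun v => F u v)
    (hFlip₁ : ∀ u u' v, |F u v - F u' v| ≤ LF * |u - u'|)
    (hFlip₂ : ∀ u v v', |F u v - F u v'| ≤ LF * |v - v'|)
    (hAmono : Monotone A)
    (hAlip : ∀ a b, |A a - A b| ≤ LA * |a - b|)
    (hCFL : 2 * LF * Δt / Δx + 2 ^ (lam + 1) * c * LA / lam * (Δt / Δx ^ lam) ≤ 1)
    (U : ℤ → ℝ) (hU : ∃ K : ℝ, ∀ i, |U i| ≤ K) :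
    (∀ i, (⨅ k, U k) ≤ schemeH c lam Δx Δt F A U i ∧
      schemeH c lam Δx Δt F A U i ≤ ⨆ k, U k) ∧
    (⨆ i, |schemeH c lam Δx Δt F A U i|) ≤ ⨆ i, |U i| := by
  obtain ⟨K, hK⟩ := hU
  have hG := fracWeight_hasSum c lam Δx hlam₀ hc hΔx
  set S := 2 ^ (lam + 1) * c / lam / Δx ^ lam with hS
  have hCFL' : Δt / Δx * (2 * LF) + Δt * (S * LA) ≤ 1 := by
    convert hCFL using 1
    rw [hS]
    ring
  have hba : BddAbove (Set.range U) := ⟨K, by rintro _ ⟨i, rfl⟩; exact (abs_le.mp (hK i)).2⟩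
  have hbb : BddBelow (Set.range U) := ⟨-K, by rintro _ ⟨i, rfl⟩; exact (abs_le.mp (hK i)).1⟩
  have hr : 0 ≤ Δt / Δx := by positivity
  have hAle : ∀ a b, a ≤ b → A b - A a ≤ LA * (b - a) := by
    intro a b hab
    have h := hAlip b a
    rw [abs_of_nonneg (sub_nonneg.mpr hab)] at h
    exact (le_abs_self _).trans h
  have hF1 : ∀ a b v, a ≤ b → F b v - F a v ≤ LF * (b - a) := by
    intro a b v hab
    have h := hFlip₁ b a v
    rw [abs_of_nonneg (sub_nonneg.mpr hab)] at h
    exact (le_abs_self _).trans h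
  have hF2 : ∀ u a b, a ≤ b → F u a - F u b ≤ LF * (b - a) := by
    intro u a b hab
    have h := hFlip₂ u a b
    rw [abs_sub_comm a b, abs_of_nonneg (sub_nonneg.mpr hab)] at h
    exact (le_abs_self _).trans h
  have hsm : ∀ i, Summable (fun j : {j : ℤ // j ≠ 0} =>
      fracWeight c lam Δx j.1 * (A (U (i + j.1)) - A (U i))) := by
    intro i
    refine Summable.of_norm_bounded (hG.summable.mul_right (A K - A (-K))) ?_
    intro j
    have hw := fracWeight_nonneg c lam Δx hc hΔx j.1 j.2
    rw [Real.norm_eq_abs, abs_mul, abs_of_nonneg hw]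
    apply mul_le_mul_of_nonneg_left _ hw
    have h1 := hAmono (abs_le.mp (hK i)).1
    have h2 := hAmono (abs_le.mp (hK i)).2
    have h3 := hAmono (abs_le.mp (hK (i + j.1))).1
    have h4 := hAmono (abs_le.mp (hK (i + j.1))).2
    rw [abs_le]
    constructor <;> linarith
  have main : ∀ i, (⨅ k, U k) ≤ schemeH c lam Δx Δt F A U i ∧
      schemeH c lam Δx Δt F A U i ≤ ⨆ k, U k := by
    intro i
    unfold schemeH
    constructor
    · set m := ⨅ k, U k with hm
      have hmU : ∀ k, m ≤ U k := fun k => ciInf_le hbb k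
      have hsum : S * (-(LA * (U i - m))) ≤ ∑' j : {j : ℤ // j ≠ 0},
          fracWeight c lam Δx j.1 * (A (U (i + j.1)) - A (U i)) := by
        refine hasSum_le ?_ (hG.mul_right (-(LA * (U i - m)))) (hsm i).hasSum
        intro j
        apply mul_le_mul_of_nonneg_left _ (fracWeight_nonneg c lam Δx hc hΔx j.1 j.2)
        have h1 := hAmono (hmU (i + j.1))
        have h2 := hAle _ _ (hmU i)
        linarith
      have hflux : F (U i) (U (i + 1)) - F (U (i - 1)) (U i) ≤ 2 * LF * (U i - m) := by
        have h1 := hFmono₂ (U i) (hmU (i + 1))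
        have h2 := hFmono₁ (U i) (hmU (i - 1))
        have h3 := hF1 _ _ (U i) (hmU i)
        have h4 := hF2 (U i) _ _ (hmU i)
        simp only at h1 h2
        linarith
      have e1 := mul_le_mul_of_nonneg_left hflux hr
      have e2 := mul_le_mul_of_nonneg_left hsum hΔt.le
      have e3 := mul_le_mul_of_nonneg_right hCFL' (sub_nonneg.mpr (hmU i))
      linarith
    · set M := ⨆ k, U k with hM
      have hMU : ∀ k, U k ≤ M := fun k => le_ciSup hba k
      have hsum : ∑' j : {j : ℤ // j ≠ 0},
          fracWeight c lam Δx j.1 * (A (U (i + j.1)) - A (U i)) ≤ S * (LA * (M - U i)) := by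
        refine hasSum_le ?_ (hsm i).hasSum (hG.mul_right (LA * (M - U i)))
        intro j
        apply mul_le_mul_of_nonneg_left _ (fracWeight_nonneg c lam Δx hc hΔx j.1 j.2)
        have h1 := hAmono (hMU (i + j.1))
        have h2 := hAle _ _ (hMU i)
        linarith
      have hflux : -(2 * LF * (M - U i)) ≤ F (U i) (U (i + 1)) - F (U (i - 1)) (U i) := by
        have h1 := hFmono₂ (U i) (hMU (i + 1))
        have h2 := hFmono₁ (U i) (hMU (i - 1))
        have h3 := hF1 _ _ (U i) (hMU i)
        have h4 := hF2 (U i) _ _ (hMU i)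
        simp only at h1 h2
        linarith
      have e1 := mul_le_mul_of_nonneg_left hflux hr
      have e2 := mul_le_mul_of_nonneg_left hsum hΔt.le
      have e3 := mul_le_mul_of_nonneg_right hCFL' (sub_nonneg.mpr (hMU i))
      linarith
  refine ⟨main, ciSup_le fun i => ?_⟩
  have hbabs : BddAbove (Set.range fun k => |U k|) := ⟨K, by rintro _ ⟨i, rfl⟩; exact hK i⟩
  have hle : ∀ k, |U k| ≤ ⨆ k, |U k| := fun k => le_ciSup hbabs k
  rw [abs_le]
  constructor
  · exact (le_ciInf fun k => (abs_le.mp (hle k)).1).trans (main i).1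
  · exact (main i).2.trans (ciSup_le fun k => (abs_le.mp (hle k)).2)
end
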